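/- Let F be a finite family of strong Pouna sets satisfying constraints (C1)–(C5). If A, B, C ∈ F, A ↷ B and A ≺ C, then B ≺ C. -/

import Mathlib

open Set

noncomputable def lS (S : Set (ℝ × ℝ)) : ℝ := sInf (Prod.fst '' S)
noncomputable def rS (S : Set (ℝ × ℝ)) : ℝ := sSup (Prod.fst '' S)
noncomputable def bS (S : Set (ℝ × ℝ)) : ℝ := sInf (Prod.snd '' S)
noncomputable def tS (S : Set (ℝ × ℝ)) : ℝ := sSup (Prod.snd '' S)

/-- The bounding box of a bounded set in the plane. -/
noncomputable def boxS (S : Set (ℝ × ℝ)) : Set (ℝ × ℝ) :=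
  Icc (lS S) (rS S) ×ˢ Icc (bS S) (tS S)

/-- A Pouna set: nonempty, compact, path-connected, not an axis-parallel rectangle. -/
def Pouna (S : Set (ℝ × ℝ)) : Prop :=
  S.Nonempty ∧ IsCompact S ∧ IsPathConnected S ∧
    ¬ ∃ a b c d : ℝ, S = Icc a b ×ˢ Icc c d

/-- The territory of a set. -/
def Ter (S : Set (ℝ × ℝ)) : Set (ℝ × ℝ) :=
  {p | p ∈ boxS S \ S ∧ ∃ x' > p.1, (x', p.2) ∈ S}

/-- A strong Pouna set: a Pouna set with nonempty territory. -/
def Strong (S : Set (ℝ × ℝ)) : Prop := Pouna S ∧ (Ter S).Nonempty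

/-- `Prec A B` (`A ≺ B`): the bounding box of `A` is inside the territory of `B`. -/
def Prec (A B : Set (ℝ × ℝ)) : Prop := boxS A ⊆ Ter B

/-- `Adj A B` (`A ↷ B`). -/
def Adj (A B : Set (ℝ × ℝ)) : Prop :=
  A ≠ B ∧ (A ∩ B).Nonempty ∧
  lS B ≤ lS A ∧ lS A < rS B ∧ rS B < rS A ∧
  bS B < bS A ∧ bS A < tS A ∧ tS A < tS B ∧
  {p : ℝ × ℝ | p ∈ A ∧ p.1 = lS A} ⊆ Ter B

def ConstraintC1 (F : Set (Set (ℝ × ℝ))) : Prop :=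
  ∀ A ∈ F, ∀ B ∈ F, A ≠ B → (A ∩ B).Nonempty → Adj A B ∨ Adj B A

def ConstraintC2 (F : Set (Set (ℝ × ℝ))) : Prop :=
  ∀ A ∈ F, ∀ B ∈ F, A ∩ B = ∅ → (A ∩ Ter B).Nonempty → Prec A B

def ConstraintC3 (F : Set (Set (ℝ × ℝ))) : Prop :=
  ∀ A ∈ F, ∀ B ∈ F, A ≠ B → (A ∩ B).Nonempty → ¬ ∃ C ∈ F, C ⊆ Ter A ∩ Ter B

def ConstraintC4 (F : Set (Set (ℝ × ℝ))) : Prop :=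
  ¬ ∃ A ∈ F, ∃ B ∈ F, ∃ C ∈ F, Prec A B ∧ Adj A C ∧ Adj B C

def ConstraintC5 (F : Set (Set (ℝ × ℝ))) : Prop :=
  ¬ ∃ A ∈ F, ∃ B ∈ F, ∃ C ∈ F, A ≠ B ∧ A ≠ C ∧ B ≠ C ∧
    (A ∩ B).Nonempty ∧ (A ∩ C).Nonempty ∧ (B ∩ C).Nonempty

theorem subset_boxS_of_isCompact {S : Set (ℝ × ℝ)} (hS : IsCompact S) : S ⊆ boxS S := by
  intro p hp
  have hx := hS.image continuous_fst
  have hy := hS.image continuous_snd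
  exact ⟨⟨csInf_le hx.bddBelow (mem_image_of_mem _ hp), le_csSup hx.bddAbove (mem_image_of_mem _ hp)⟩,
    ⟨csInf_le hy.bddBelow (mem_image_of_mem _ hp), le_csSup hy.bddAbove (mem_image_of_mem _ hp)⟩⟩

/-- Axiom (A3) for a finite family of strong Pouna sets satisfying (C1)-(C5). -/
theorem stmt_8 (F : Set (Set (ℝ × ℝ))) (hfin : F.Finite)
    (hstrong : ∀ S ∈ F, Strong S)
    (h1 : ConstraintC1 F) (h2 : ConstraintC2 F) (h3 : ConstraintC3 F)
    (h4 : ConstraintC4 F) (h5 : ConstraintC5 F)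
    (A B C : Set (ℝ × ℝ)) (hA : A ∈ F) (hB : B ∈ F) (hC : C ∈ F)
    (hAB : Adj A B) (hAC : Prec A C) :
    Prec B C := by
  have ⟨_, ⟨p, hpA, hpB⟩, _, hlr, hrr, _, hbt, _, _⟩ := hAB
  have hpC : p ∈ Ter C := hAC (subset_boxS_of_isCompact (hstrong A hA).1.2.1 hpA)
  rcases (B ∩ C).eq_empty_or_nonempty with hBC | hBC
  · exact h2 B hB C hC hBC ⟨p, hpB, hpC⟩
  have hne : B ≠ C := fun h => hpC.1.2 (h ▸ hpB)
  rcases h1 B hB C hC hne hBC with h | h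
  · have hcorner : (rS A, bS A) ∈ boxS A :=
      ⟨⟨(hlr.trans hrr).le, le_rfl⟩, ⟨le_rfl, hbt.le⟩⟩
    have hAC' : rS A ≤ rS C := (hAC hcorner).1.1.1.2
    have hCB : rS C < rS B := h.2.2.2.2.1
    linarith
  · exact (h4 ⟨A, hA, C, hC, B, hB, hAC, hAB, h⟩).elim
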